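/- Let H be a Hilbert space (over ℝ or ℂ), let Y and Z be normed spaces, let B : H → Y be a bounded linear operator and K : H → Z be a compact linear operator. Assume there is C > 0 with ‖u‖_H ≤ C (‖B u‖_Y + ‖K u‖_Z) for all u ∈ H, and that B is injective. Then there exists C' > 0 such that ‖u‖_H ≤ C' ‖B u‖_Y for all u ∈ H. -/

import Mathlib

open Filter Topology in
/-- In a Banach space, an injective operator that is bounded below up to a compact operator is
bounded below. -/
theorem exists_norm_le_mul_norm_of_isCompactOperator {𝕜 : Type*} [RCLike 𝕜] {H Y Z : Type*}
    [NormedAddCommGroup H] [NormedSpace 𝕜 H] [CompleteSpace H]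
    [NormedAddCommGroup Y] [NormedSpace 𝕜 Y]
    [NormedAddCommGroup Z] [NormedSpace 𝕜 Z]
    (B : H →L[𝕜] Y) (K : H →L[𝕜] Z) (hK : IsCompactOperator K)
    {C : ℝ} (hineq : ∀ u, ‖u‖ ≤ C * (‖B u‖ + ‖K u‖)) (hinj : Function.Injective B) :
    ∃ C' > 0, ∀ u, ‖u‖ ≤ C' * ‖B u‖ := by
  by_contra! hcon
  have hseq (n : ℕ) : ∃ u : H, ‖u‖ = 1 ∧ ‖B u‖ ≤ 1 / ((n : ℝ) + 1) := by
    have hn : (0 : ℝ) < n + 1 := by positivity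
    obtain ⟨u, hu⟩ := hcon (n + 1) hn
    have hpos : 0 < ‖u‖ := lt_of_le_of_lt (by positivity) hu
    refine ⟨((‖u‖⁻¹ : ℝ) : 𝕜) • u, ?_, ?_⟩
    · rw [norm_smul, RCLike.norm_ofReal, abs_of_pos (inv_pos.2 hpos), inv_mul_cancel₀ hpos.ne']
    · rw [map_smul, norm_smul, RCLike.norm_ofReal, abs_of_pos (inv_pos.2 hpos),
        inv_mul_le_iff₀ hpos, mul_one_div, le_div_iff₀ hn, mul_comm]
      exact hu.le
  choose u hu hBu using hseq
  have hB : Tendsto (fun n ↦ B (u n)) atTop (𝓝 0) :=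
    squeeze_zero_norm hBu tendsto_one_div_add_atTop_nhds_zero_nat
  obtain ⟨S, hS, hKS⟩ :=
    IsCompactOperator.image_closedBall_subset_compact (f := K.toLinearMap) hK 1
  obtain ⟨z, -, φ, hφ, hz⟩ := hS.tendsto_subseq (x := fun n ↦ K (u n)) fun n ↦
    hKS ⟨u n, by simp [hu n], rfl⟩
  have hanti : AntilipschitzWith (2 * C).toNNReal (B.prod K) := by
    refine AddMonoidHomClass.antilipschitz_of_bound _ fun x ↦ ?_
    have hx : ‖B x‖ + ‖K x‖ ≤ 2 * ‖B.prod K x‖ := by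
      have h₁ : ‖B x‖ ≤ ‖B.prod K x‖ := norm_fst_le (B.prod K x)
      have h₂ : ‖K x‖ ≤ ‖B.prod K x‖ := norm_snd_le (B.prod K x)
      linarith
    calc ‖x‖ ≤ C * (‖B x‖ + ‖K x‖) := hineq x
      _ ≤ C.toNNReal * (2 * ‖B.prod K x‖) := by
        gcongr
        exact Real.le_coe_toNNReal C
      _ = (2 * C).toNNReal * ‖B.prod K x‖ := by
        rw [Real.toNNReal_mul zero_le_two]
        push_cast
        simp
        ring
  have hemb := hanti.isClosedEmbedding (B.prod K).uniformContinuous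
  have hlim : Tendsto (fun n ↦ B.prod K (u (φ n))) atTop (𝓝 (0, z)) :=
    (hB.comp hφ.tendsto_atTop).prodMk_nhds hz
  obtain ⟨x, hx⟩ := hemb.isClosed_range.mem_of_tendsto hlim (.of_forall fun n ↦ ⟨_, rfl⟩)
  have hx₀ : x = 0 := hinj (by simpa using congrArg Prod.fst hx)
  have hux : Tendsto (fun n ↦ u (φ n)) atTop (𝓝 0) :=
    hemb.tendsto_nhds_iff.2 (by rwa [← hx₀, hx])
  have h₁ := hux.norm
  simp only [hu, norm_zero] at h₁
  exact one_ne_zero (tendsto_nhds_unique tendsto_const_nhds h₁)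


/-- The compactness–uniqueness argument: if `‖u‖ ≤ C (‖B u‖ + ‖K u‖)` with `K` compact and `B`
injective, then the strong observability `‖u‖ ≤ C' ‖B u‖` holds. -/
theorem stmt_12 {𝕜 : Type*} [RCLike 𝕜] {H Y Z : Type*}
    [NormedAddCommGroup H] [InnerProductSpace 𝕜 H] [CompleteSpace H]
    [NormedAddCommGroup Y] [NormedSpace 𝕜 Y]
    [NormedAddCommGroup Z] [NormedSpace 𝕜 Z]
    (B : H →L[𝕜] Y) (K : H →L[𝕜] Z) (hK : IsCompactOperator K)
    (C : ℝ) (hC : 0 < C) (hineq : ∀ u, ‖u‖ ≤ C * (‖B u‖ + ‖K u‖))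
    (hinj : Function.Injective B) :
    ∃ C' > 0, ∀ u, ‖u‖ ≤ C' * ‖B u‖ := by
  exact exists_norm_le_mul_norm_of_isCompactOperator B K hK hineq hinj
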